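/- Let A = ∏_{i=1}^n A^i with each A^i finite and nonempty, let U^i : A → ℝ be payoff functions, and let τ > 0. Then there exists a mixed-strategy profile π* = (π*^1,…,π*^n), π*^i ∈ Δ(A^i), such that for every player i and every a^i ∈ A^i, π*^i(a^i) = exp(q^i(a^i)/τ) / Σ_{b^i∈A^i} exp(q^i(b^i)/τ), where q^i(a^i) := Σ_{a^{-i}} ∏_{j≠i} π*^j(a^j) U^i(a^i, a^{-i}). In other words, every finite n-player game with entropy perturbation and temperature τ admits a Nash distribution. -/

import Mathlib

open Finset

/-- A set of points and slack indices dominates `T` if every point of `T` is, with respect to some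
index whose slack is not in the set, no greater than all points of the set. -/
def ScarfDominating {I T L : Type*} [LinearOrder L] (r : I → T → L) (S : Finset (T ⊕ I)) : Prop :=
  ∀ y, ∃ i, Sum.inr i ∉ S ∧ ∀ x, Sum.inl x ∈ S → r i y ≤ r i x

section Parity

variable {I V : Type*} [Fintype I] [DecidableEq I] [DecidableEq V]

lemma even_card_filter_image_erase (c : V → I) (i₀ : I) (R : Finset V)
    (hR : R.card = Fintype.card I) (hc : R.image c ≠ univ) :
    Even (R.filter fun v => (R.erase v).image c = univ.erase i₀).card := by
  rcases (R.filter fun v => (R.erase v).image c = univ.erase i₀).eq_empty_or_nonempty with h | ⟨v, hv⟩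
  · simp [h]
  obtain ⟨hvR, hv⟩ := mem_filter.1 hv
  have hinj : Set.InjOn c (R.erase v : Finset V) := by
    rw [← card_image_iff, hv, card_erase_of_mem hvR, card_erase_of_mem (mem_univ _), hR, card_univ]
  have hcv : c v ≠ i₀ := by
    intro h
    apply hc
    rw [← insert_erase hvR, image_insert, hv, h, insert_erase (mem_univ _)]
  have : c v ∈ (R.erase v).image c := by rw [hv]; simp [hcv]
  obtain ⟨w, hw, hwv⟩ := mem_image.1 this
  have hwR := mem_of_mem_erase hw
  have hne := ne_of_mem_erase hw
  suffices (R.filter fun v => (R.erase v).image c = univ.erase i₀) = {v, w} by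
    rw [this, card_pair hne.symm]; exact even_two
  ext u
  simp only [mem_filter, mem_insert, mem_singleton]
  constructor
  · rintro ⟨hu, hcu⟩
    by_contra! hcon
    have hu' : u ∈ R.erase v := mem_erase.2 ⟨hcon.1, hu⟩
    have h1 : c u ∈ (R.erase u).image c := by
      rw [hcu, ← hv]; exact mem_image_of_mem _ hu'
    obtain ⟨z, hz, hzu⟩ := mem_image.1 h1
    by_cases hzv : z = v
    · subst hzv
      exact hcon.2 (hinj hu' hw (by rw [← hzu, hwv]))
    · exact ne_of_mem_erase hz (hinj (mem_erase.2 ⟨hzv, mem_of_mem_erase hz⟩) hu' hzu)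
  · rintro (rfl | rfl)
    · exact ⟨hvR, hv⟩
    · refine ⟨hwR, ?_⟩
      rw [← hv]
      ext k
      simp only [mem_image, mem_erase]
      constructor
      · rintro ⟨z, ⟨hz, hzR⟩, rfl⟩
        by_cases hzv : z = v
        · exact ⟨u, ⟨hne, hwR⟩, by rw [hzv, hwv]⟩
        · exact ⟨z, ⟨hzv, hzR⟩, rfl⟩
      · rintro ⟨z, ⟨hz, hzR⟩, rfl⟩
        by_cases hzv : z = u
        · exact ⟨v, ⟨hne.symm, hvR⟩, by rw [hzv, hwv]⟩
        · exact ⟨z, ⟨hzv, hzR⟩, rfl⟩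

/-- The parity argument behind Sperner-type lemmas: if all but one of the doors coloured by
`univ.erase i₀` lie in an even number of rooms, then some room carries all colours. -/
lemma exists_image_eq_univ_of_parity [Fintype V] (c : V → I) (i₀ : I) (P : Finset V → Prop)
    [DecidablePred P] (S₀ : Finset V) (hS₀ : S₀.card + 1 = Fintype.card I)
    (hcS₀ : S₀.image c = univ.erase i₀)
    (hodd : Odd (univ.filter fun v => v ∉ S₀ ∧ P (insert v S₀)).card)
    (heven : ∀ S : Finset V, S.card + 1 = Fintype.card I → S.image c = univ.erase i₀ → S ≠ S₀ →
      Even (univ.filter fun v => v ∉ S ∧ P (insert v S)).card) :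
    ∃ R, P R ∧ R.image c = univ := by
  by_contra! hcon
  set D : Finset (Finset V) :=
    univ.filter fun S => S.card + 1 = Fintype.card I ∧ S.image c = univ.erase i₀ with hD
  set Q : Finset (Finset V) := univ.filter fun R => R.card = Fintype.card I ∧ P R with hQ
  have hcount : ∑ S ∈ D, (univ.filter fun v => v ∉ S ∧ P (insert v S)).card =
      ∑ R ∈ Q, (R.filter fun v => (R.erase v).image c = univ.erase i₀).card := by
    rw [← card_sigma, ← card_sigma]
    refine card_bij' (fun p _ => ⟨insert p.2 p.1, p.2⟩) (fun p _ => ⟨p.1.erase p.2, p.2⟩) ?_ ?_ ?_ ?_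
    · rintro ⟨S, v⟩ h
      simp only [hD, hQ, mem_sigma, mem_filter, mem_univ, true_and] at h ⊢
      obtain ⟨⟨h1, h2⟩, h3, h4⟩ := h
      refine ⟨⟨by rw [card_insert_of_notMem h3, h1], h4⟩, mem_insert_self _ _, ?_⟩
      rwa [erase_insert h3]
    · rintro ⟨R, v⟩ h
      simp only [hD, hQ, mem_sigma, mem_filter, mem_univ, true_and] at h ⊢
      obtain ⟨⟨h1, h2⟩, h3, h4⟩ := h
      refine ⟨⟨by rw [card_erase_add_one h3, h1], h4⟩, by simp, ?_⟩
      rwa [insert_erase h3]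
    · rintro ⟨S, v⟩ h
      simp only [mem_sigma, mem_filter] at h
      simp [erase_insert h.2.2.1]
    · rintro ⟨R, v⟩ h
      simp only [mem_sigma, mem_filter] at h
      simp [insert_erase h.2.1]
  have h1 : Even (∑ R ∈ Q, (R.filter fun v => (R.erase v).image c = univ.erase i₀).card) := by
    refine Finset.even_sum _ fun R hR => ?_
    simp only [hQ, mem_filter, mem_univ, true_and] at hR
    exact even_card_filter_image_erase c i₀ R hR.1 (hcon R hR.2)
  rw [← hcount, ← add_sum_erase D _ (show S₀ ∈ D by simp [hD, hS₀, hcS₀])] at h1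
  have h2 : Even (∑ S ∈ D.erase S₀, (univ.filter fun v => v ∉ S ∧ P (insert v S)).card) := by
    refine Finset.even_sum _ fun S hS => ?_
    simp only [hD, mem_erase, mem_filter, mem_univ, true_and] at hS
    exact heven S hS.2.1 hS.2.2 hS.1
  exact Nat.not_even_iff_odd.2 (hodd.add_even h2) h1

end Parity

section Scarf

variable {I T L : Type*} [Fintype I] [Fintype T] [DecidableEq I] [DecidableEq T] [LinearOrder L]

open Classical in
lemma even_card_scarfDominating_insert (r : I → T → L) (hr : ∀ i, Function.Injective (r i))
    (S : Finset (T ⊕ I)) (hS : S.card + 1 = Fintype.card I) (hne : ∃ x, Sum.inl x ∈ S) :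
    Even (univ.filter fun v => v ∉ S ∧ ScarfDominating r (insert v S)).card := by
  by_cases hdom : ScarfDominating r S
  swap
  · rw [filter_false_of_mem]
    · simp
    rintro v - ⟨-, hv⟩
    refine hdom fun y => ?_
    obtain ⟨i, hi, h⟩ := hv y
    exact ⟨i, fun h' => hi (mem_insert_of_mem h'), fun x hx => h x (mem_insert_of_mem hx)⟩
  set σ : Finset T := S.toLeft with hσ
  set C : Finset I := S.toRightᶜ with hC
  have hσm : ∀ x, x ∈ σ ↔ Sum.inl x ∈ S := fun x => by simp [hσ]
  have hCm : ∀ i, i ∈ C ↔ Sum.inr i ∉ S := fun x => by simp [hC]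
  have hcard : C.card = σ.card + 1 := by
    have h1 := S.card_toLeft_add_card_toRight
    have h2 : S.toRight.card + C.card = Fintype.card I := S.toRight.card_add_card_compl
    rw [← hσ] at h1
    omega
  have hσne : σ.Nonempty := by
    obtain ⟨x, hx⟩ := hne
    exact ⟨x, (hσm x).2 hx⟩
  choose m hmσ hm using fun i => exists_min_image σ (r i) hσne
  have hmin : ∀ i x, x ∈ σ → (∀ z ∈ σ, r i x ≤ r i z) → m i = x := fun i x hx h =>
    hr i (le_antisymm (hm i x hx) (h _ (hmσ i)))
  have hdom' : ∀ y, ∃ i ∈ C, r i y ≤ r i (m i) := by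
    intro y
    obtain ⟨i, hi, h⟩ := hdom y
    exact ⟨i, (hCm i).2 hi, h _ ((hσm _).1 (hmσ i))⟩
  have hsurj : ∀ x ∈ σ, ∃ i ∈ C, m i = x := by
    intro x hx
    obtain ⟨i, hi, h⟩ := hdom' x
    exact ⟨i, hi, hmin i x hx fun z hz => h.trans (hm i z hz)⟩
  obtain ⟨a, ha, b, hb, hab, hmab⟩ := exists_ne_map_eq_of_card_lt_of_maps_to
    (s := C) (t := σ) (f := m) (by omega) (fun i _ => hmσ i)
  have hinj : ∀ j, j = a ∨ j = b → Set.InjOn m (C.erase j : Finset I) := by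
    intro j hj
    have hjC : j ∈ C := by rcases hj with rfl | rfl <;> assumption
    have himg : (C.erase j).image m = σ := by
      refine Subset.antisymm (image_subset_iff.2 fun i _ => hmσ i) fun x hx => ?_
      obtain ⟨i, hi, rfl⟩ := hsurj x hx
      by_cases hij : i = j
      · rcases hj with rfl | rfl
        · exact mem_image.2 ⟨b, mem_erase.2 ⟨hab.symm, hb⟩, by rw [hij, hmab]⟩
        · exact mem_image.2 ⟨a, mem_erase.2 ⟨hab, ha⟩, by rw [hij, hmab]⟩
      · exact mem_image_of_mem _ (mem_erase.2 ⟨hij, hi⟩)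
    rw [← card_image_iff, himg, card_erase_of_mem hjC, hcard, Nat.add_sub_cancel]
  have hpair : ∀ j ∈ C, ∀ k ∈ C, k ≠ j → m k = m j → j = a ∨ j = b := by
    intro j hj k hk hkj h
    by_contra! hcon
    by_cases hka : k = a
    · exact hkj (hinj b (Or.inr rfl) (by simp [ha, hka, hab]) (by simp [hj, hcon]) h)
    · exact hkj (hinj a (Or.inl rfl) (by simp [hk, hka]) (by simp [hj, hcon]) h)
  have hother : ∀ j, j = a ∨ j = b → ∀ x ∈ σ, ∃ k ∈ C, k ≠ j ∧ m k = x := by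
    intro j hj x hx
    obtain ⟨i, hi, rfl⟩ := hsurj x hx
    by_cases hij : i = j
    · rcases hj with rfl | rfl
      · exact ⟨b, hb, hab.symm, by rw [hij, hmab]⟩
      · exact ⟨a, ha, hab, by rw [hij, hmab]⟩
    · exact ⟨i, hi, hij, rfl⟩
  let Q : I → Finset T := fun j => univ.filter fun y => ∀ k ∈ C, k ≠ j → r k (m k) < r k y
  have hQm : ∀ j y, y ∈ Q j ↔ ∀ k ∈ C, k ≠ j → r k (m k) < r k y := fun j y => by simp [Q]
  have hQle : ∀ j, ∀ y ∈ Q j, j ∈ C ∧ r j y ≤ r j (m j) := by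
    intro j y hy
    obtain ⟨i, hi, h⟩ := hdom' y
    by_cases hij : i = j
    · exact hij ▸ ⟨hi, h⟩
    · exact absurd h (not_le.2 ((hQm j y).1 hy i hi hij))
  let G : I → T ⊕ I → Prop := fun j v => (v = Sum.inr j ∧ Q j = ∅) ∨
    ∃ x, v = Sum.inl x ∧ x ∈ Q j ∧ ∀ y ∈ Q j, r j y ≤ r j x
  have hGu : ∀ j, ∃ v, G j v ∧ ∀ w, G j w → w = v := by
    intro j
    rcases (Q j).eq_empty_or_nonempty with h | h
    · refine ⟨Sum.inr j, Or.inl ⟨rfl, h⟩, ?_⟩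
      rintro w (⟨rfl, -⟩ | ⟨x, -, hx, -⟩)
      · rfl
      · simp [h] at hx
    · obtain ⟨x, hx, hmax⟩ := exists_max_image (Q j) (r j) h
      refine ⟨Sum.inl x, Or.inr ⟨x, rfl, hx, hmax⟩, ?_⟩
      rintro w (⟨-, h'⟩ | ⟨z, rfl, hz, hz'⟩)
      · exact absurd h' h.ne_empty
      · rw [hr j (le_antisymm (hmax z hz) (hz' x hx))]
  have hGdom : ∀ j, j = a ∨ j = b → ∀ v, G j v → v ∉ S ∧ ScarfDominating r (insert v S) := by
    intro j hj v hv
    have hjC : j ∈ C := by rcases hj with rfl | rfl <;> assumption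
    rcases hv with ⟨rfl, hQ⟩ | ⟨x, rfl, hx, hmax⟩
    · refine ⟨(hCm j).1 hjC, fun y => ?_⟩
      have hy : y ∉ Q j := by simp [hQ]
      rw [hQm] at hy
      push Not at hy
      obtain ⟨k, hk, hkj, h⟩ := hy
      refine ⟨k, by simp [hkj, (hCm k).1 hk], fun x hx => ?_⟩
      exact h.trans (hm k x ((hσm x).2 (by simpa using hx)))
    · have hxσ : x ∉ σ := by
        intro hxσ
        obtain ⟨k, hk, hkj, rfl⟩ := hother j hj x hxσ
        exact lt_irrefl _ ((hQm j _).1 hx k hk hkj)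
      refine ⟨fun h => hxσ ((hσm x).2 h), fun y => ?_⟩
      by_cases hy : y ∈ Q j
      · refine ⟨j, by simpa using (hCm j).1 hjC, fun z hz => ?_⟩
        rcases mem_insert.1 hz with hz | hz
        · rw [Sum.inl.inj hz]; exact hmax y hy
        · exact (hQle j y hy).2.trans (hm j z ((hσm z).2 hz))
      · rw [hQm] at hy
        push Not at hy
        obtain ⟨k, hk, hkj, h⟩ := hy
        refine ⟨k, by simpa using (hCm k).1 hk, fun z hz => ?_⟩
        rcases mem_insert.1 hz with hz | hz
        · rw [Sum.inl.inj hz]; exact h.trans ((hQm j x).1 hx k hk hkj).le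
        · exact h.trans (hm k z ((hσm z).2 hz))
  have hdomG : ∀ v, v ∉ S → ScarfDominating r (insert v S) → G a v ∨ G b v := by
    intro v hvS hv
    suffices ∃ j, (j = a ∨ j = b) ∧ G j v by
      obtain ⟨j, rfl | rfl, h⟩ := this
      exacts [Or.inl h, Or.inr h]
    rcases v with x | j
    · have hxσ : x ∉ σ := fun h => hvS ((hσm x).1 h)
      have hv' : ∀ y, ∃ i ∈ C, r i y ≤ r i x ∧ ∀ z ∈ σ, r i y ≤ r i z := by
        intro y
        obtain ⟨i, hi, h⟩ := hv y
        exact ⟨i, (hCm i).2 fun h' => hi (mem_insert_of_mem h'), h x (mem_insert_self _ _),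
          fun z hz => h z (mem_insert_of_mem ((hσm z).1 hz))⟩
      obtain ⟨j, hj, -, hjx⟩ := hv' x
      have hkey : ∀ z ∈ σ, ∃ k ∈ C, k ≠ j ∧ m k = z ∧ r k z < r k x := by
        intro z hz
        obtain ⟨k, hk, h1, h2⟩ := hv' z
        refine ⟨k, hk, ?_, hmin k z hz h2, lt_of_le_of_ne h1 fun h => hxσ (hr k h ▸ hz)⟩
        rintro rfl
        exact hxσ (hr k (le_antisymm h1 (hjx z hz)) ▸ hz)
      obtain ⟨k, hk, hkj, hmk, -⟩ := hkey (m j) (hmσ j)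
      have hjab := hpair j hj k hk hkj hmk
      refine ⟨j, hjab, Or.inr ⟨x, rfl, ?_, ?_⟩⟩
      · rw [hQm]
        intro l hl hlj
        obtain ⟨k', hk', hkj', hmk', hlt⟩ := hkey (m l) (hmσ l)
        rwa [hinj j hjab (by simp [hk', hkj']) (by simp [hl, hlj]) hmk'] at hlt
      · intro y hy
        obtain ⟨i, hi, h1, h2⟩ := hv' y
        by_cases hij : i = j
        · exact hij ▸ h1
        · exact absurd (h2 _ (hmσ i)) (not_le.2 ((hQm j y).1 hy i hi hij))
    · have hjC : j ∈ C := (hCm j).2 hvS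
      have hv' : ∀ y, ∃ k ∈ C, k ≠ j ∧ ∀ z ∈ σ, r k y ≤ r k z := by
        intro y
        obtain ⟨k, hk, h⟩ := hv y
        simp only [mem_insert, Sum.inr.injEq, not_or] at hk
        exact ⟨k, (hCm k).2 hk.2, hk.1, fun z hz => h z (mem_insert_of_mem ((hσm z).1 hz))⟩
      obtain ⟨k, hk, hkj, h⟩ := hv' (m j)
      refine ⟨j, hpair j hjC k hk hkj (hmin k _ (hmσ j) h), Or.inl ⟨rfl, ?_⟩⟩
      refine eq_empty_of_forall_notMem fun y hy => ?_
      obtain ⟨k, hk, hkj, h⟩ := hv' y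
      exact absurd (h _ (hmσ k)) (not_le.2 ((hQm j y).1 hy k hk hkj))
  obtain ⟨va, hva, hva'⟩ := hGu a
  obtain ⟨vb, hvb, hvb'⟩ := hGu b
  have hvab : va ≠ vb := by
    rintro rfl
    rcases hva with ⟨rfl, -⟩ | ⟨x, rfl, hx, -⟩
    · rcases hvb with ⟨h, -⟩ | ⟨x, h, -⟩
      · exact hab (Sum.inr.inj h)
      · cases h
    · rcases hvb with ⟨h, -⟩ | ⟨z, h, hz, -⟩
      · cases h
      · obtain rfl := Sum.inl.inj h
        exact absurd (hQle a x hx).2 (not_le.2 ((hQm b x).1 hz a ha hab))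
  suffices (univ.filter fun v => v ∉ S ∧ ScarfDominating r (insert v S)) = {va, vb} by
    rw [this, card_pair hvab]; exact even_two
  ext v
  simp only [mem_filter, mem_univ, true_and, mem_insert, mem_singleton]
  constructor
  · rintro ⟨h1, h2⟩
    exact (hdomG v h1 h2).imp (hva' v) (hvb' v)
  · rintro (rfl | rfl)
    · exact hGdom a (Or.inl rfl) _ hva
    · exact hGdom b (Or.inr rfl) _ hvb

open Classical in
/-- **Scarf's lemma** for colourings: some dominating set of points and slacks carries all
colours. -/
theorem exists_scarfDominating_image_eq_univ [Nonempty I] [Nonempty T] (r : I → T → L)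
    (hr : ∀ i, Function.Injective (r i)) (c : T → I) :
    ∃ S : Finset (T ⊕ I), ScarfDominating r S ∧ S.image (Sum.elim c id) = univ := by
  obtain ⟨i₀⟩ := ‹Nonempty I›
  have hI : 0 < Fintype.card I := Fintype.card_pos_iff.2 ⟨i₀⟩
  refine exists_image_eq_univ_of_parity (Sum.elim c id) i₀ (ScarfDominating r)
    ((univ.erase i₀).map .inr) ?_ ?_ ?_ ?_
  · rw [card_map, card_erase_of_mem (mem_univ _), card_univ]
    omega
  · ext k; simp
  · obtain ⟨x, -, hx⟩ := exists_max_image (univ : Finset T) (r i₀) univ_nonempty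
    suffices (univ.filter fun v => v ∉ (univ.erase i₀).map (.inr : I ↪ T ⊕ I) ∧
        ScarfDominating r (insert v ((univ.erase i₀).map .inr))) = {Sum.inl x} by
      rw [this, card_singleton]; exact odd_one
    ext v
    simp only [mem_filter, mem_univ, true_and, mem_singleton]
    constructor
    · rintro ⟨h1, h2⟩
      obtain ⟨i, hi, h⟩ := h2 x
      have hii : i = i₀ := by
        by_contra hne
        exact hi (mem_insert_of_mem (by simpa using hne))
      subst hii
      rcases v with z | j
      · rw [hr i (le_antisymm (hx z (mem_univ _)) (h z (mem_insert_self _ _)))]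
      · have : j = i := by simpa using h1
        exact absurd (mem_insert_self _ _) (this ▸ hi)
    · rintro rfl
      refine ⟨by simp, fun y => ⟨i₀, by simp, fun z hz => ?_⟩⟩
      have : z = x := by simpa using hz
      exact this ▸ hx y (mem_univ _)
  · intro S hS hcS hne
    refine even_card_scarfDominating_insert r hr S hS ?_
    by_contra! hcon
    apply hne
    have hsub : S ⊆ (univ.erase i₀).map .inr := by
      rintro (x | j) hv
      · exact absurd hv (hcon x)
      · have : j ∈ S.image (Sum.elim c id) := mem_image.2 ⟨_, hv, rfl⟩
        rw [hcS] at this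
        simpa using this
    refine eq_of_subset_of_card_le hsub ?_
    rw [card_map, card_erase_of_mem (mem_univ _), card_univ]
    omega

end Scarf

section Brouwer

open Filter Topology

variable {I : Type*} [Fintype I] [Nonempty I]

/-- The discrete form of Brouwer's theorem: among the lattice points of the simplex of size `N`,
coloured arbitrarily, points of every colour `i` with `μ i ≠ 0` occur
near a common point `μ`. -/
lemma exists_nearby_lattice_points [DecidableEq I] (N : ℕ) (c : (I → ℕ) → I) :
    ∃ μ : I → ℕ, ∑ i, μ i ≤ N ∧ N ≤ ∑ i, μ i + Fintype.card I ∧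
      ∀ i, μ i = 0 ∨ ∃ x : I → ℕ, ∑ k, x k = N ∧ c x = i ∧
        ∀ k, μ k ≤ x k ∧ x k ≤ μ k + Fintype.card I := by
  let T := {x // x ∈ piAntidiag (univ : Finset I) N}
  have hT : ∀ x : T, ∑ k, x.1 k = N := fun x => (mem_piAntidiag.1 x.2).1
  have mkT : ∀ x : I → ℕ, ∑ k, x k = N → x ∈ piAntidiag (univ : Finset I) N := fun x hx =>
    mem_piAntidiag.2 ⟨hx, fun i _ => mem_univ i⟩
  obtain ⟨i₁⟩ := ‹Nonempty I›
  have : Nonempty I := ⟨i₁⟩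
  have : Nonempty T := ⟨⟨Pi.single i₁ N, mkT _ (by simp)⟩⟩
  let e := Fintype.equivFin T
  let r : I → T → ℕ ×ₗ Fin (Fintype.card T) := fun i x => toLex (x.1 i, e x)
  have hr : ∀ i, Function.Injective (r i) := by
    intro i x y h
    have := congrArg (fun p => (ofLex p).2) h
    exact e.injective this
  have hrle : ∀ i x y, r i x ≤ r i y → x.1 i ≤ y.1 i := fun i x y h =>
    Prod.Lex.monotone_fst _ _ h
  obtain ⟨S, hS, hc⟩ := exists_scarfDominating_image_eq_univ r hr (fun x => c x.1)
  have hcol : ∀ i, Sum.inr i ∉ S → ∃ x : T, Sum.inl x ∈ S ∧ c x.1 = i := by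
    intro i hi
    have : i ∈ S.image (Sum.elim (fun x : T => c x.1) id) := by rw [hc]; exact mem_univ i
    obtain ⟨x | j, hx, rfl⟩ := mem_image.1 this
    · exact ⟨x, hx, rfl⟩
    · exact absurd hx hi
  have hne : S.toLeft.Nonempty := by
    obtain ⟨i, hi, -⟩ := hS (Classical.arbitrary T)
    obtain ⟨x, hx, -⟩ := hcol i hi
    exact ⟨x, by simpa using hx⟩
  choose m hmS hm using fun i => exists_min_image S.toLeft (fun x : T => x.1 i) hne
  let μ : I → ℕ := fun i => if Sum.inr i ∈ S then 0 else (m i).1 i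
  have hμ : ∀ x : T, Sum.inl x ∈ S → ∀ k, μ k ≤ x.1 k := by
    intro x hx k
    by_cases hk : Sum.inr k ∈ S
    · simp [μ, hk]
    · simpa [μ, hk] using hm k x (by simpa using hx)
  obtain ⟨x₀, hx₀⟩ := hne
  have hsum : ∑ i, μ i ≤ N := (sum_le_sum fun k _ => hμ x₀ (by simpa using hx₀) k).trans (hT x₀).le
  have hsum' : N ≤ ∑ i, μ i + Fintype.card I := by
    by_contra! hlt
    let y : I → ℕ := fun i => μ i + 1 + if i = i₁ then N - (∑ i, μ i + Fintype.card I) else 0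
    have hy : ∑ k, y k = N := by
      simp only [y, sum_add_distrib, sum_ite_eq', mem_univ, if_true, sum_const, card_univ,
        smul_eq_mul, mul_one]
      omega
    obtain ⟨i, hi, h⟩ := hS ⟨y, mkT y hy⟩
    have h1 : y i ≤ (m i).1 i := hrle i _ _ (h (m i) (by simpa using hmS i))
    have h2 : μ i = (m i).1 i := by simp [μ, hi]
    simp only [y] at h1
    omega
  refine ⟨μ, hsum, hsum', fun i => ?_⟩
  by_cases hi : Sum.inr i ∈ S
  · left; simp [μ, hi]
  · right
    obtain ⟨x, hx, hxi⟩ := hcol i hi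
    refine ⟨x.1, hT x, hxi, fun k => ⟨hμ x hx k, ?_⟩⟩
    have h1 : ∑ j ∈ univ.erase k, μ j ≤ ∑ j ∈ univ.erase k, x.1 j :=
      sum_le_sum fun j _ => hμ x hx j
    have h2 := add_sum_erase univ μ (mem_univ k)
    have h3 := add_sum_erase univ x.1 (mem_univ k)
    rw [hT x] at h3
    omega

/-- **Brouwer's fixed point theorem** for the standard simplex. -/
theorem exists_fixedPoint_stdSimplex (f : (I → ℝ) → I → ℝ)
    (hf : ContinuousOn f (stdSimplex ℝ I)) (hmaps : Set.MapsTo f (stdSimplex ℝ I) (stdSimplex ℝ I)) :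
    ∃ x ∈ stdSimplex ℝ I, f x = x := by
  classical
  have hcolor : ∀ x ∈ stdSimplex ℝ I, ∃ i, x i ≤ f x i := by
    intro x hx
    by_contra! h
    have := sum_lt_sum_of_nonempty univ_nonempty fun i _ => h i
    rw [(hmaps hx).2, hx.2] at this
    exact lt_irrefl _ this
  let sc : ℕ → (I → ℕ) → I → ℝ := fun n x i => (x i : ℝ) / (n + 1 : ℕ)
  have hN : ∀ n : ℕ, (0 : ℝ) < (n + 1 : ℕ) := fun n => by positivity
  have hsc : ∀ n x, ∑ k, x k = n + 1 → sc n x ∈ stdSimplex ℝ I := by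
    intro n x hx
    refine ⟨fun i => by positivity, ?_⟩
    simp only [sc]
    rw [← sum_div, ← Nat.cast_sum, hx, div_self (hN n).ne']
  have hcol : ∀ n, ∃ c : (I → ℕ) → I, ∀ x, ∑ k, x k = n + 1 →
      sc n x (c x) ≤ f (sc n x) (c x) := by
    intro n
    have : ∀ x : I → ℕ, ∃ i, ∑ k, x k = n + 1 → sc n x i ≤ f (sc n x) i := by
      intro x
      by_cases hx : ∑ k, x k = n + 1
      · obtain ⟨i, hi⟩ := hcolor _ (hsc n x hx)
        exact ⟨i, fun _ => hi⟩
      · exact ⟨Classical.arbitrary I, fun h => absurd h hx⟩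
    exact ⟨_, fun x => (this x).choose_spec⟩
  choose c hc using hcol
  choose μ hμ1 hμ2 hμ using fun n => exists_nearby_lattice_points (n + 1) (c n)
  have hbox : ∀ n, sc n (μ n) ∈ Set.Icc (0 : I → ℝ) 1 := by
    intro n
    refine ⟨fun i => by positivity, fun i => ?_⟩
    simp only [sc, Pi.one_apply]
    rw [div_le_one (hN n)]
    exact_mod_cast (single_le_sum (fun _ _ => Nat.zero_le _) (mem_univ i)).trans (hμ1 n)
  obtain ⟨p, hp, φ, hφ, hlim⟩ := isCompact_Icc.tendsto_subseq hbox
  have hsmall : Tendsto (fun n => (Fintype.card I : ℝ) / (φ n + 1 : ℕ)) atTop (𝓝 0) :=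
    ((tendsto_const_div_atTop_nhds_zero_nat (Fintype.card I : ℝ)).comp
      (tendsto_add_atTop_nat 1)).comp hφ.tendsto_atTop
  have hlimi : ∀ i, Tendsto (fun n => sc (φ n) (μ (φ n)) i) atTop (𝓝 (p i)) :=
    fun i => (tendsto_pi_nhds.1 hlim) i
  have hps : p ∈ stdSimplex ℝ I := by
    refine ⟨hp.1, ?_⟩
    have h1 : Tendsto (fun n => ∑ i, sc (φ n) (μ (φ n)) i) atTop (𝓝 (∑ i, p i)) :=
      tendsto_finsetSum _ fun i _ => hlimi i
    have h2 : Tendsto (fun n => ∑ i, sc (φ n) (μ (φ n)) i) atTop (𝓝 1) := by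
      have h3 : Tendsto (fun n => 1 - (Fintype.card I : ℝ) / (φ n + 1 : ℕ)) atTop (𝓝 1) := by
        simpa using hsmall.const_sub 1
      refine tendsto_of_tendsto_of_tendsto_of_le_of_le h3 tendsto_const_nhds ?_ ?_
      · intro n
        simp only [sc]
        rw [← sum_div, sub_le_iff_le_add, ← add_div, one_le_div (hN _)]
        exact_mod_cast hμ2 (φ n)
      · intro n
        simp only [sc]
        rw [← sum_div, div_le_one (hN _)]
        exact_mod_cast hμ1 (φ n)
    exact tendsto_nhds_unique h1 h2
  have hle : ∀ i, p i ≤ f p i := by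
    intro i
    rcases (hps.1 i).eq_or_lt with h0 | hpos
    · rw [← h0]; exact (hmaps hps).1 i
    have hev : ∀ᶠ n in atTop, ∃ x : I → ℕ, ∑ k, x k = φ n + 1 ∧ c (φ n) x = i ∧
        ∀ k, μ (φ n) k ≤ x k ∧ x k ≤ μ (φ n) k + Fintype.card I := by
      filter_upwards [(hlimi i).eventually (lt_mem_nhds hpos)] with n hn
      refine (hμ (φ n) i).resolve_left fun h => ?_
      simp [sc, h] at hn
    obtain ⟨M, hM⟩ := eventually_atTop.1 hev
    choose! x hx1 hx2 hx3 using hM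
    have hxlim : Tendsto (fun n => sc (φ n) (x n)) atTop (𝓝 p) := by
      refine tendsto_pi_nhds.2 fun k => ?_
      have h4 : Tendsto (fun n => sc (φ n) (μ (φ n)) k + (Fintype.card I : ℝ) / (φ n + 1 : ℕ))
          atTop (𝓝 (p k)) := by
        simpa using (hlimi k).add hsmall
      refine tendsto_of_tendsto_of_tendsto_of_le_of_le' (hlimi k) h4 ?_ ?_
      · filter_upwards [eventually_ge_atTop M] with n hn
        exact div_le_div_of_nonneg_right (by exact_mod_cast (hx3 n hn k).1) (hN _).le
      · filter_upwards [eventually_ge_atTop M] with n hn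
        simp only [sc]
        rw [← add_div]
        exact div_le_div_of_nonneg_right (by exact_mod_cast (hx3 n hn k).2) (hN _).le
    have hmem : ∀ᶠ n in atTop, sc (φ n) (x n) ∈ stdSimplex ℝ I := by
      filter_upwards [eventually_ge_atTop M] with n hn using hsc _ _ (hx1 n hn)
    have hflim : Tendsto (fun n => f (sc (φ n) (x n))) atTop (𝓝 (f p)) :=
      (hf p hps).tendsto.comp (tendsto_nhdsWithin_iff.2 ⟨hxlim, hmem⟩)
    refine le_of_tendsto_of_tendsto (tendsto_pi_nhds.1 hxlim i) (tendsto_pi_nhds.1 hflim i) ?_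
    filter_upwards [eventually_ge_atTop M] with n hn
    have := hc (φ n) (x n) (hx1 n hn)
    rwa [hx2 n hn] at this
  refine ⟨p, hps, funext fun i => ?_⟩
  have := (sum_eq_sum_iff_of_le fun i _ => hle i).1 (by rw [hps.2, (hmaps hps).2])
  exact (this i (mem_univ i)).symm

end Brouwer

/-- Every finite n-player game with entropy perturbation and temperature
`τ > 0` admits a Nash distribution: a profile `π*` in which each `π*^i` is the softmax of
the expected payoff vector `q^i(a^i) = Σ_{a^{-i}} Π_{j≠i} π*^j(a^j) U^i(a^i, a^{-i})`. -/
theorem stmt9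
    {n : ℕ} {A : Fin n → Type*} [∀ i, Fintype (A i)] [∀ i, Nonempty (A i)]
    [∀ i, DecidableEq (A i)]
    (U : Fin n → (∀ i, A i) → ℝ)
    (τ : ℝ) (hτ : 0 < τ) :
    ∃ π : ∀ i, A i → ℝ,
      (∀ i, π i ∈ stdSimplex ℝ (A i)) ∧
      ∀ (i : Fin n) (ai : A i),
        π i ai =
          Real.exp ((∑ a : ∀ j, A j, if a i = ai then
              (∏ j ∈ univ.erase i, π j (a j)) * U i a else 0) / τ)
          / ∑ bi : A i, Real.exp ((∑ a : ∀ j, A j, if a i = bi then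
              (∏ j ∈ univ.erase i, π j (a j)) * U i a else 0) / τ) := by
  rcases n.eq_zero_or_pos with rfl | hn
  · exact ⟨fun i => i.elim0, fun i => i.elim0, fun i => i.elim0⟩
  have : Nonempty (Σ i, A i) := ⟨⟨⟨0, hn⟩, Classical.arbitrary _⟩⟩
  have hn' : (n : ℝ) ≠ 0 := by positivity
  let q : ((Σ i, A i) → ℝ) → ∀ i, A i → ℝ := fun x i ai =>
    ∑ a : ∀ j, A j, if a i = ai then (∏ j ∈ univ.erase i, n * x ⟨j, a j⟩) * U i a else 0
  let s : ((Σ i, A i) → ℝ) → ∀ i, A i → ℝ := fun x i ai =>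
    Real.exp (q x i ai / τ) / ∑ bi, Real.exp (q x i bi / τ)
  have hpos : ∀ x i, 0 < ∑ bi, Real.exp (q x i bi / τ) := fun x i =>
    sum_pos (fun _ _ => Real.exp_pos _) univ_nonempty
  have hs : ∀ x i, s x i ∈ stdSimplex ℝ (A i) := fun x i =>
    ⟨fun ai => div_nonneg (Real.exp_pos _).le (hpos x i).le, by
      simp only [s]; rw [← sum_div, div_self (hpos x i).ne']⟩
  have hq : ∀ i ai, Continuous fun x => q x i ai := by
    intro i ai
    refine continuous_finsetSum _ fun a _ => ?_
    split_ifs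
    · fun_prop
    · fun_prop
  have hsc : ∀ i ai, Continuous fun x => s x i ai := fun i ai =>
    (((hq i ai).div_const τ).rexp).div
      (continuous_finsetSum _ fun bi _ => ((hq i bi).div_const τ).rexp) fun x => (hpos x i).ne'
  let F : ((Σ i, A i) → ℝ) → (Σ i, A i) → ℝ := fun x k => s x k.1 k.2 / n
  have hF : Continuous F := continuous_pi fun k => (hsc k.1 k.2).div_const _
  have hFmaps : Set.MapsTo F (stdSimplex ℝ (Σ i, A i)) (stdSimplex ℝ (Σ i, A i)) := by
    intro x _
    refine ⟨fun k => div_nonneg ((hs x k.1).1 k.2) n.cast_nonneg, ?_⟩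
    have h : ∑ i, ∑ ai, s x i ai = n := by simp [fun i => (hs x i).2]
    simp only [F]
    rw [← sum_div, Fintype.sum_sigma, h, div_self hn']
  obtain ⟨x, -, hx⟩ := exists_fixedPoint_stdSimplex F hF.continuousOn hFmaps
  have hfix : ∀ i ai, (n : ℝ) * x ⟨i, ai⟩ = s x i ai := fun i ai => by
    rw [← congrFun hx ⟨i, ai⟩]
    exact mul_div_cancel₀ _ hn'
  refine ⟨fun i ai => n * x ⟨i, ai⟩, fun i => ?_, fun i ai => hfix i ai⟩
  beta_reduce
  rw [funext (hfix i)]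
  exact hs x i
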